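/- Fix integers d ≥ 2 and N ≥ 1, a traceless Hermitian matrix h ∈ M_d(ℂ), and a unit vector ψ_N ∈ (ℂ^d)^{⊗N}. For U ∈ SU(d^N) define F^{LU}(U) := sup over all N-tuples (V_1,…,V_N) of d×d unitary matrices of 4·(tr(ρ_V H_N²) − (tr(ρ_V H_N))²), where ρ_V := (V_1⊗⋯⊗V_N)·U|ψ_N⟩⟨ψ_N|U†·(V_1⊗⋯⊗V_N)†. Then for every ε ≥ 0, μ(d^N){ U ∈ SU(d^N) : F^{LU}(U) ≤ 4N·tr(h²)·d^N/(d·(d^N+1)) − ε } ≤ exp(−ε²·d^N/(4096·‖h‖⁴·N⁴)). -/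

import Mathlib

open MeasureTheory Matrix Finset
open scoped ComplexOrder

noncomputable section

namespace Paper

instance matrixMeasurableSpace {m n : Type*} : MeasurableSpace (Matrix m n ℂ) :=
  (inferInstance : MeasurableSpace (m → n → ℂ))

/-- The operator norm (w.r.t. the Euclidean norm) of a square matrix. -/
def opNorm {n : Type*} [Fintype n] [DecidableEq n] (A : Matrix n n ℂ) : ℝ :=
  ‖Matrix.toEuclideanCLM (𝕜 := ℂ) A‖

/-- The Hamiltonian `H_N = Σ_j h^{(j)}` on `N` particles, acting as `h` on the `j`-th
tensor factor and as the identity on the others. -/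
def localHam (d N : ℕ) (h : Matrix (Fin d) (Fin d) ℂ) :
    Matrix (Fin N → Fin d) (Fin N → Fin d) ℂ :=
  ∑ j : Fin N, Matrix.of fun x y =>
    if ∀ i, i ≠ j → x i = y i then h (x j) (y j) else 0

/-- The tensor product `V_1 ⊗ ⋯ ⊗ V_N` of `N` one-particle matrices. -/
def tensorProd {d N : ℕ} (V : Fin N → Matrix (Fin d) (Fin d) ℂ) :
    Matrix (Fin N → Fin d) (Fin N → Fin d) ℂ :=
  Matrix.of fun x y => ∏ j, V j (x j) (y j)

/-- The LU-optimized quantum Fisher information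
`F^{LU}(U) = sup_{V_1,…,V_N unitary} 4·(tr(ρ_V H_N²) − (tr(ρ_V H_N))²)` where
`ρ_V = (V_1⊗⋯⊗V_N)·U|ψ⟩⟨ψ|U†·(V_1⊗⋯⊗V_N)†`. -/
def FLU (d N : ℕ) (h : Matrix (Fin d) (Fin d) ℂ) (ψ : (Fin N → Fin d) → ℂ)
    (U : Matrix.specialUnitaryGroup (Fin N → Fin d) ℂ) : ℝ :=
  ⨆ V : Fin N → Matrix.unitaryGroup (Fin d) ℂ,
    4 * ((Matrix.trace
            ((tensorProd fun j => (V j : Matrix (Fin d) (Fin d) ℂ)) *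
              (U.1 * Matrix.vecMulVec ψ (star ψ) * star U.1) *
              star (tensorProd fun j => (V j : Matrix (Fin d) (Fin d) ℂ)) *
              (localHam d N h * localHam d N h))).re -
        ((Matrix.trace
            ((tensorProd fun j => (V j : Matrix (Fin d) (Fin d) ℂ)) *
              (U.1 * Matrix.vecMulVec ψ (star ψ) * star U.1) *
              star (tensorProd fun j => (V j : Matrix (Fin d) (Fin d) ℂ)) *
              localHam d N h)).re) ^ 2)

section Unitary

open scoped Matrix.Norms.L2Operator
open NormedSpace

variable {n : Type*} [Fintype n]

lemma trace_vecMulVec_mul (φ χ : n → ℂ) (X : Matrix n n ℂ) :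
    Matrix.trace (Matrix.vecMulVec φ χ * X) = χ ⬝ᵥ (X *ᵥ φ) := by
  rw [Matrix.vecMulVec_mul, Matrix.trace_vecMulVec, dotProduct_comm, Matrix.dotProduct_mulVec]

lemma star_dotProduct_self_of_unit {φ : n → ℂ} (hφ : ∑ x, ‖φ x‖ ^ 2 = 1) : star φ ⬝ᵥ φ = 1 := by
  have : star φ ⬝ᵥ φ = ((∑ x, ‖φ x‖ ^ 2 : ℝ) : ℂ) := by
    simp [dotProduct, Complex.conj_mul']
  rw [this, hφ, Complex.ofReal_one]

variable [DecidableEq n]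

instance : ProperSpace (Matrix n n ℂ) := FiniteDimensional.proper ℂ _

instance : BorelSpace (Matrix n n ℂ) := inferInstanceAs (BorelSpace (n → n → ℂ))

/-- The pure state `U|ψ⟩⟨ψ|U†`. -/
def rotatedState (ψ : n → ℂ) (U : Matrix.specialUnitaryGroup n ℂ) : Matrix n n ℂ :=
  U.1 * Matrix.vecMulVec ψ (star ψ) * star U.1

lemma continuous_rotatedState (ψ : n → ℂ) : Continuous (rotatedState ψ) := by
  unfold rotatedState
  fun_prop

lemma rotatedState_eq_vecMulVec (ψ : n → ℂ) (U : Matrix.specialUnitaryGroup n ℂ) :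
    rotatedState ψ U = Matrix.vecMulVec (U.1 *ᵥ ψ) (star (U.1 *ᵥ ψ)) := by
  rw [rotatedState, Matrix.mul_vecMulVec, Matrix.vecMulVec_mul, Matrix.star_mulVec]
  rfl

lemma norm_star_dotProduct_mulVec_le {φ : n → ℂ} (hφ : star φ ⬝ᵥ φ = 1) (X : Matrix n n ℂ) :
    ‖star φ ⬝ᵥ (X *ᵥ φ)‖ ≤ ‖X‖ := by
  have h1 : ‖WithLp.toLp 2 φ‖ = 1 := by
    have h2 : inner ℂ (WithLp.toLp 2 φ) (WithLp.toLp 2 φ) = (1 : ℂ) := by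
      rw [EuclideanSpace.inner_toLp_toLp, dotProduct_comm, hφ]
    have h3 := inner_self_eq_norm_sq (𝕜 := ℂ) (WithLp.toLp 2 φ)
    rw [h2, RCLike.one_re] at h3
    nlinarith [norm_nonneg (WithLp.toLp 2 φ)]
  calc ‖star φ ⬝ᵥ (X *ᵥ φ)‖ = ‖inner ℂ (WithLp.toLp 2 φ) (WithLp.toLp 2 (X *ᵥ φ))‖ := by
        rw [EuclideanSpace.inner_toLp_toLp, dotProduct_comm]
    _ ≤ ‖WithLp.toLp 2 φ‖ * ‖WithLp.toLp 2 (X *ᵥ φ)‖ := norm_inner_le_norm _ _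
    _ ≤ ‖X‖ := by
        have := Matrix.l2_opNorm_mulVec X (WithLp.toLp 2 φ)
        simp only [h1, mul_one, one_mul] at this ⊢
        exact this

lemma star_dotProduct_mulVec_unitary {g : Matrix n n ℂ} (hg : star g * g = 1) {φ : n → ℂ}
    (hφ : star φ ⬝ᵥ φ = 1) : star (g *ᵥ φ) ⬝ᵥ (g *ᵥ φ) = 1 := by
  rw [Matrix.star_mulVec, Matrix.dotProduct_mulVec, Matrix.vecMul_vecMul]
  change star φ ᵥ* (star g * g) ⬝ᵥ φ = 1
  rw [hg, Matrix.vecMul_one, hφ]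

lemma norm_vecMulVec_star_le {φ : n → ℂ} (hφ : star φ ⬝ᵥ φ = 1) :
    ‖Matrix.vecMulVec φ (star φ)‖ ≤ 1 := by
  have h1 : star (Matrix.vecMulVec φ (star φ)) * Matrix.vecMulVec φ (star φ) =
      Matrix.vecMulVec φ (star φ) := by
    rw [Matrix.star_eq_conjTranspose, Matrix.conjTranspose_vecMulVec, star_star,
      Matrix.vecMulVec_mul_vecMulVec, hφ, one_smul]
  have h2 := CStarRing.norm_star_mul_self (x := Matrix.vecMulVec φ (star φ))
  rw [h1] at h2
  nlinarith [norm_nonneg (Matrix.vecMulVec φ (star φ)),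
    sq_nonneg (‖Matrix.vecMulVec φ (star φ)‖ - 1)]

lemma star_mul_self_of_specialUnitary (U : Matrix.specialUnitaryGroup n ℂ) : star U.1 * U.1 = 1 :=
  (Matrix.mem_unitaryGroup_iff').1 (Matrix.specialUnitaryGroup_le_unitaryGroup U.2)

lemma norm_rotatedState_le {ψ : n → ℂ} (hψ : star ψ ⬝ᵥ ψ = 1)
    (U : Matrix.specialUnitaryGroup n ℂ) : ‖rotatedState ψ U‖ ≤ 1 := by
  rw [rotatedState_eq_vecMulVec]
  exact norm_vecMulVec_star_le
    (star_dotProduct_mulVec_unitary (star_mul_self_of_specialUnitary U) hψ)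

lemma exists_bound_comp_rotatedState {E : Type*} [NormedAddCommGroup E] {ψ : n → ℂ}
    (hψ : star ψ ⬝ᵥ ψ = 1) {Φ : Matrix n n ℂ → E} (hΦ : Continuous Φ) :
    ∃ C, ∀ U, ‖Φ (rotatedState ψ U)‖ ≤ C := by
  obtain ⟨C, hC⟩ := (isCompact_closedBall (0 : Matrix n n ℂ) 1).exists_bound_of_continuousOn
    hΦ.continuousOn
  exact ⟨C, fun U => hC _ (by simpa using norm_rotatedState_le hψ U)⟩

instance : BorelSpace (Matrix.specialUnitaryGroup n ℂ) :=
  inferInstanceAs (BorelSpace (Subtype fun U => U ∈ Matrix.specialUnitaryGroup n ℂ))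

variable (μ : Measure (Matrix.specialUnitaryGroup n ℂ))

lemma integrable_comp_rotatedState [IsProbabilityMeasure μ] {E : Type*}
    [NormedAddCommGroup E] [SecondCountableTopology E] {ψ : n → ℂ}
    (hψ : star ψ ⬝ᵥ ψ = 1) {Φ : Matrix n n ℂ → E} (hΦ : Continuous Φ) :
    Integrable (fun U => Φ (rotatedState ψ U)) μ := by
  obtain ⟨C, hC⟩ := exists_bound_comp_rotatedState hψ hΦ
  exact Integrable.of_bound
    (hΦ.comp (continuous_rotatedState ψ)).aestronglyMeasurable C (.of_forall hC)

lemma integral_comp_unitary_conj [μ.IsMulLeftInvariant] [Nonempty n] (ψ : n → ℂ)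
    (Φ : Matrix n n ℂ → ℂ)
    {g : Matrix n n ℂ} (hg : g ∈ Matrix.unitaryGroup n ℂ) :
    ∫ U, Φ (g * rotatedState ψ U * star g) ∂μ = ∫ U, Φ (rotatedState ψ U) ∂μ := by
  obtain ⟨c, hc⟩ := IsAlgClosed.exists_pow_nat_eq (Matrix.det g) (Fintype.card_pos (α := n))
  have hc1 : ‖c‖ = 1 := by
    have h1 : ‖c‖ ^ Fintype.card n = 1 := by
      rw [← norm_pow, hc]
      exact CStarRing.norm_of_mem_unitary (Matrix.det_of_mem_unitary hg)
    exact (pow_eq_one_iff_of_nonneg (norm_nonneg c) Fintype.card_ne_zero).1 h1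
  have hc0 : c ≠ 0 := by
    rintro rfl
    simp at hc1
  have hcc : c⁻¹ * star c⁻¹ = 1 := by
    rw [Complex.star_def, Complex.mul_conj', norm_inv, hc1]
    simp
  have hs : c⁻¹ • g ∈ Matrix.specialUnitaryGroup n ℂ := by
    rw [Matrix.mem_specialUnitaryGroup_iff]
    constructor
    · rw [Matrix.mem_unitaryGroup_iff, star_smul, smul_mul_smul_comm, hcc, one_smul]
      exact Matrix.mem_unitaryGroup_iff.1 hg
    · rw [Matrix.det_smul, ← hc, ← mul_pow, inv_mul_cancel₀ hc0, one_pow]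
  have hm : Measurable fun U : Matrix.specialUnitaryGroup n ℂ =>
      (⟨c⁻¹ • g, hs⟩ : Matrix.specialUnitaryGroup n ℂ) * U := by
    apply Continuous.measurable
    fun_prop
  let e : Matrix.specialUnitaryGroup n ℂ ≃ᵐ Matrix.specialUnitaryGroup n ℂ :=
    { toEquiv := Equiv.mulLeft ⟨c⁻¹ • g, hs⟩
      measurable_toFun := hm
      measurable_invFun := by
        apply Continuous.measurable
        simp only [Equiv.mulLeft_symm]
        exact continuous_const.mul continuous_id }
  have hmap : μ.map e = μ := Measure.IsMulLeftInvariant.map_mul_left_eq_self _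
  conv_rhs => rw [← hmap, integral_map_equiv]
  congr 1
  ext U
  congr 1
  change _ = (c⁻¹ • g * U.1) * Matrix.vecMulVec ψ (star ψ) * star (c⁻¹ • g * U.1)
  rw [star_mul, star_smul, rotatedState]
  simp only [smul_mul_assoc, mul_smul_comm, smul_smul, mul_comm (star c⁻¹), hcc, one_smul,
    mul_assoc]

lemma hasDerivAt_exp_conj (B R : Matrix n n ℂ) (hB : star B = -B) (t : ℝ) :
    HasDerivAt (fun t : ℝ => exp (t • B) * R * star (exp (t • B)))
      (B * (exp (t • B) * R * star (exp (t • B))) -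
        (exp (t • B) * R * star (exp (t • B))) * B) t := by
  have h1 : HasDerivAt (fun t : ℝ => exp (t • B)) (B * exp (t • B)) t :=
    hasDerivAt_exp_smul_const' B t
  have h2 := (h1.mul_const R).mul h1.star
  refine h2.congr_deriv ?_
  rw [star_mul, hB]
  noncomm_ring

variable [IsProbabilityMeasure μ] [μ.IsMulLeftInvariant]

/-- Integration by parts for skew-Hermitian directions: a left-invariant measure annihilates the
infinitesimal rotations. -/
lemma integral_fderiv_commutator_of_skew [Nonempty n] {ψ : n → ℂ} (hψ : star ψ ⬝ᵥ ψ = 1)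
    {Φ : Matrix n n ℂ → ℂ} (hΦ : ContDiff ℂ 1 Φ) {B : Matrix n n ℂ} (hB : star B = -B) :
    ∫ U, fderiv ℂ Φ (rotatedState ψ U) (B * rotatedState ψ U - rotatedState ψ U * B) ∂μ = 0 := by
  have hu (t : ℝ) : exp (t • B) ∈ Matrix.unitaryGroup n ℂ := by
    let +nondep : NormedAlgebra ℚ (Matrix n n ℂ) := .restrictScalars ℚ ℂ _
    apply exp_mem_unitary_of_mem_skewAdjoint
    rw [skewAdjoint.mem_iff, star_smul, hB, smul_neg, star_trivial]
  let R : ℝ → Matrix.specialUnitaryGroup n ℂ → Matrix n n ℂ := fun t U =>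
    exp (t • B) * rotatedState ψ U * star (exp (t • B))
  have hR (t : ℝ) (U) : ‖R t U‖ ≤ 1 := by
    have h1 : ‖exp (t • B)‖ = 1 := CStarRing.norm_of_mem_unitary (hu t)
    calc ‖R t U‖ ≤ ‖exp (t • B)‖ * ‖rotatedState ψ U‖ * ‖star (exp (t • B))‖ :=
          (norm_mul_le _ _).trans (by gcongr; exact norm_mul_le _ _)
      _ ≤ 1 := by rw [norm_star, h1, one_mul, mul_one]; exact norm_rotatedState_le hψ U
  have hR0 (U) : R 0 U = rotatedState ψ U := by simp [R]
  have hRc (t : ℝ) : Continuous (R t) :=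
    (continuous_const.mul (continuous_rotatedState ψ)).mul continuous_const
  have hc : Continuous fun M : Matrix n n ℂ => fderiv ℂ Φ M (B * M - M * B) :=
    (hΦ.continuous_fderiv one_ne_zero).clm_apply (by fun_prop)
  obtain ⟨C, hC⟩ := (isCompact_closedBall (0 : Matrix n n ℂ) 1).exists_bound_of_continuousOn
    hc.continuousOn
  have key := (hasDerivAt_integral_of_dominated_loc_of_deriv_le (μ := μ) (x₀ := (0 : ℝ))
    (s := Set.univ) (F := fun t U => Φ (R t U))
    (F' := fun t U => fderiv ℂ Φ (R t U) (B * R t U - R t U * B)) (bound := fun _ => C)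
    Filter.univ_mem
    (.of_forall fun t => (hΦ.continuous.comp (hRc t)).aestronglyMeasurable)
    (by simpa only [hR0] using integrable_comp_rotatedState μ hψ hΦ.continuous)
    (hc.comp (hRc 0)).aestronglyMeasurable
    (.of_forall fun U t _ => hC _ (by simpa using hR t U))
    (integrable_const C)
    (.of_forall fun U t _ => ?_)).2
  · have h2 : (fun t => ∫ U, Φ (R t U) ∂μ) = fun _ => ∫ U, Φ (rotatedState ψ U) ∂μ :=
      funext fun t => integral_comp_unitary_conj μ ψ Φ (hu t)
    rw [h2] at key
    simpa only [hR0] using key.unique (hasDerivAt_const _ _)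
  · have h3 : HasFDerivAt Φ ((fderiv ℂ Φ (R t U)).restrictScalars ℝ) (R t U) :=
      ((hΦ.differentiable one_ne_zero).differentiableAt.hasFDerivAt).restrictScalars ℝ
    exact h3.comp_hasDerivAt t (hasDerivAt_exp_conj B (rotatedState ψ U) hB t)

/-- Integration by parts in arbitrary complex directions. -/
lemma integral_fderiv_commutator [Nonempty n] {ψ : n → ℂ} (hψ : star ψ ⬝ᵥ ψ = 1)
    {Φ : Matrix n n ℂ → ℂ} (hΦ : ContDiff ℂ 1 Φ) (B : Matrix n n ℂ) :
    ∫ U, fderiv ℂ Φ (rotatedState ψ U) (B * rotatedState ψ U - rotatedState ψ U * B) ∂μ = 0 := by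
  have hint (B : Matrix n n ℂ) : Integrable (fun U => fderiv ℂ Φ (rotatedState ψ U)
      (B * rotatedState ψ U - rotatedState ψ U * B)) μ :=
    integrable_comp_rotatedState (Φ := fun M => fderiv ℂ Φ M (B * M - M * B)) μ hψ
      ((hΦ.continuous_fderiv one_ne_zero).clm_apply (by fun_prop))
  have h1 := integral_fderiv_commutator_of_skew μ hψ hΦ (B := (1 / 2 : ℂ) • (B - star B))
    (by rw [star_smul, star_sub, star_star]; simp [← smul_neg])
  have h2 := integral_fderiv_commutator_of_skew μ hψ hΦ
    (B := (-Complex.I / 2 : ℂ) • (B + star B))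
    (by rw [star_smul, star_add, star_star]; simp [add_comm, neg_div])
  have hd (M : Matrix n n ℂ) : B * M - M * B =
      (((1 / 2 : ℂ) • (B - star B)) * M - M * ((1 / 2 : ℂ) • (B - star B))) + Complex.I •
      (((-Complex.I / 2 : ℂ) • (B + star B)) * M - M * ((-Complex.I / 2 : ℂ) • (B + star B))) := by
    have h4 : Complex.I * (-Complex.I / 2) = 1 / 2 := by
      rw [mul_div_assoc', mul_neg, Complex.I_mul_I, neg_neg]
    simp only [smul_mul_assoc, mul_smul_comm, ← smul_sub, smul_smul, h4]
    rw [← smul_add]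
    have h5 : B * M - M * B = (1 / 2 : ℂ) • ((2 : ℂ) • (B * M - M * B)) := by
      rw [smul_smul]; norm_num
    rw [h5, two_smul]
    congr 1
    noncomm_ring
  simp_rw [hd, map_add, map_smul]
  rw [integral_add (hint _) (g := fun U => Complex.I • fderiv ℂ Φ (rotatedState ψ U) _)
    ((hint _).smul Complex.I), integral_smul, h1, h2]
  simp

/-- The linear functional `M ↦ tr (M X)`. -/
def traceMulCLM (X : Matrix n n ℂ) : Matrix n n ℂ →L[ℂ] ℂ :=
  LinearMap.toContinuousLinearMap ((Matrix.traceLinearMap n ℂ ℂ).comp (LinearMap.mulRight ℂ X))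

lemma traceMulCLM_apply (X M : Matrix n n ℂ) : traceMulCLM X M = Matrix.trace (M * X) := rfl

/-- The linear functional `M ↦ M i j`. -/
def entryCLM (i j : n) : Matrix n n ℂ →L[ℂ] ℂ :=
  LinearMap.toContinuousLinearMap (Matrix.entryLinearMap ℂ ℂ i j)

omit [DecidableEq n] in
lemma entryCLM_apply (i j : n) (M : Matrix n n ℂ) : entryCLM i j M = M i j := rfl

/-- The commutator `[M, H² - tr(M H) H]`, whose divergence along the orbit of pure states is an
affine function of the variance of `H`. -/
def poissonField (H M : Matrix n n ℂ) : Matrix n n ℂ :=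
  M * (H * H - traceMulCLM H M • H) - (H * H - traceMulCLM H M • H) * M

/-- The variance `tr(M H²) - tr(M H)²`, as a polynomial in the matrix `M`. -/
def variancePoly (H M : Matrix n n ℂ) : ℂ :=
  traceMulCLM (H * H) M - traceMulCLM H M ^ 2

lemma contDiff_poissonField (H : Matrix n n ℂ) : ContDiff ℂ 1 (poissonField H) := by
  unfold poissonField
  fun_prop

lemma contDiff_variancePoly (H : Matrix n n ℂ) : ContDiff ℂ 1 (variancePoly H) := by
  unfold variancePoly
  fun_prop

lemma fderiv_poissonField_mul_exp (H M C : Matrix n n ℂ) (s : ℂ) (i j : n) :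
    fderiv ℂ (fun M => entryCLM i j (poissonField H M) * Complex.exp (s * variancePoly H M)) M C =
      ((C * (H * H - Matrix.trace (M * H) • H) - (H * H - Matrix.trace (M * H) • H) * C) i j -
        Matrix.trace (C * H) * (M * H - H * M) i j +
        s * (poissonField H M i j *
          Matrix.trace (C * (H * H - (2 * Matrix.trace (M * H)) • H)))) *
        Complex.exp (s * variancePoly H M) := by
  have hΦ : ContDiff ℂ 1
      (fun M => entryCLM i j (poissonField H M) * Complex.exp (s * variancePoly H M)) := by
    have h1 := contDiff_poissonField H
    have h2 := contDiff_variancePoly H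
    fun_prop
  rw [← (hΦ.differentiable one_ne_zero).differentiableAt.lineDeriv_eq_fderiv]
  apply HasLineDerivAt.lineDeriv
  have hγ : HasDerivAt (fun t : ℂ => M + t • C) C 0 := by
    simpa using ((hasDerivAt_id (0 : ℂ)).smul_const C).const_add M
  have hq (X : Matrix n n ℂ) : HasDerivAt (fun t : ℂ => traceMulCLM X (M + t • C))
      (traceMulCLM X C) 0 :=
    ((traceMulCLM X).hasFDerivAt (x := M + (0 : ℂ) • C)).comp_hasDerivAt 0 hγ
  have hA := ((hq H).smul_const H).const_sub (H * H)
  have hW := (hγ.mul hA).sub (hA.mul hγ)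
  have hE := ((entryCLM i j).hasFDerivAt).comp_hasDerivAt 0 hW
  have hV := (((hq (H * H)).sub ((hq H).pow 2)).const_mul s).cexp
  refine (hE.mul hV).congr_deriv ?_
  simp only [Function.comp_apply, Pi.sub_apply, Pi.mul_apply, Pi.pow_apply, zero_smul, add_zero]
  rw [← sub_eq_zero]
  simp only [variancePoly, poissonField, entryCLM_apply, traceMulCLM_apply, Matrix.sub_apply,
    Matrix.add_apply, Matrix.mul_sub, Matrix.mul_smul, Matrix.trace_sub, Matrix.trace_smul,
    smul_eq_mul, Matrix.mul_neg, Matrix.neg_mul, Matrix.smul_mul, Matrix.sub_mul,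
    Matrix.smul_apply, Matrix.neg_apply]
  ring

lemma single_mul_mul_apply (i j : n) (X Y : Matrix n n ℂ) (k l : n) :
    (X * Matrix.single i j 1 * Y : Matrix n n ℂ) k l = X k i * Y j l := by
  rw [Matrix.mul_apply, Finset.sum_eq_single j]
  · simp
  · intro b _ hb
    simp [Matrix.mul_single_apply_of_ne, hb]
  · simp

lemma trace_single_commutator_mul (i j : n) (M X : Matrix n n ℂ) :
    Matrix.trace ((Matrix.single i j 1 * M - M * Matrix.single i j 1) * X) =
      (M * X - X * M) j i := by
  rw [Matrix.sub_mul, Matrix.trace_sub, Matrix.mul_assoc, Matrix.mul_assoc, Matrix.trace_mul_comm M,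
    Matrix.mul_assoc, Matrix.trace_single_mul, Matrix.trace_single_mul]
  simp

lemma sum_double_commutator_apply (M A : Matrix n n ℂ) :
    ∑ i, ∑ j, ((Matrix.single i j 1 * M - M * Matrix.single i j 1) * A -
      A * (Matrix.single i j 1 * M - M * Matrix.single i j 1) : Matrix n n ℂ) i j =
      2 * (Fintype.card n * Matrix.trace (M * A) - Matrix.trace M * Matrix.trace A) := by
  have h1 (i j : n) : ((Matrix.single i j 1 * M - M * Matrix.single i j 1) * A -
      A * (Matrix.single i j 1 * M - M * Matrix.single i j 1) : Matrix n n ℂ) i j =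
      (M * A) j j - M i i * A j j - A i i * M j j + (A * M) i i := by
    have e : ((Matrix.single i j 1 * M - M * Matrix.single i j 1) * A -
      A * (Matrix.single i j 1 * M - M * Matrix.single i j 1) : Matrix n n ℂ) =
      1 * Matrix.single i j 1 * (M * A) - M * Matrix.single i j 1 * A
      - A * Matrix.single i j 1 * M + (A * M) * Matrix.single i j 1 * 1 := by noncomm_ring
    rw [e, Matrix.add_apply, Matrix.sub_apply, Matrix.sub_apply, single_mul_mul_apply,
      single_mul_mul_apply, single_mul_mul_apply, single_mul_mul_apply]
    simp only [Matrix.one_apply_eq, one_mul, mul_one]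
  simp only [h1, Finset.sum_add_distrib, Finset.sum_sub_distrib, ← Finset.mul_sum,
    ← Finset.sum_mul, Finset.sum_const, Finset.card_univ, nsmul_eq_mul]
  have h2 (X : Matrix n n ℂ) : ∑ i, X i i = Matrix.trace X := rfl
  simp only [h2]
  rw [Matrix.trace_mul_comm A M]
  ring

omit [DecidableEq n] in
lemma sum_apply_mul_apply_swap (X Y : Matrix n n ℂ) :
    ∑ i, ∑ j, X j i * Y i j = Matrix.trace (X * Y) := by
  rw [Finset.sum_comm]
  rfl

omit [DecidableEq n] in
lemma vecMulVec_star_mul_mul {φ : n → ℂ} (X : Matrix n n ℂ) :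
    Matrix.vecMulVec φ (star φ) * X * Matrix.vecMulVec φ (star φ) =
      Matrix.trace (Matrix.vecMulVec φ (star φ) * X) • Matrix.vecMulVec φ (star φ) := by
  rw [trace_vecMulVec_mul, Matrix.vecMulVec_mul, Matrix.vecMulVec_mul_vecMulVec,
    Matrix.dotProduct_mulVec, Matrix.vecMulVec_smul]

/-- A projection of rank one, expressed through its compressions. -/
structure IsPureState (ρ : Matrix n n ℂ) : Prop where
  trace_eq_one : Matrix.trace ρ = 1
  mul_mul : ∀ X, ρ * X * ρ = Matrix.trace (ρ * X) • ρ
  norm_trace_mul_le : ∀ X, ‖Matrix.trace (ρ * X)‖ ≤ ‖X‖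
  isHermitian : ρ.IsHermitian

lemma isPureState_vecMulVec {φ : n → ℂ} (hφ : star φ ⬝ᵥ φ = 1) :
    IsPureState (Matrix.vecMulVec φ (star φ)) where
  trace_eq_one := by rw [Matrix.trace_vecMulVec, dotProduct_comm, hφ]
  mul_mul := vecMulVec_star_mul_mul
  norm_trace_mul_le X := by
    rw [trace_vecMulVec_mul]
    exact norm_star_dotProduct_mulVec_le hφ X
  isHermitian := by
    rw [Matrix.IsHermitian, Matrix.conjTranspose_vecMulVec, star_star]

namespace IsPureState

variable {ρ : Matrix n n ℂ} (hρ : IsPureState ρ)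

include hρ

lemma mul_self : ρ * ρ = ρ := by
  have := hρ.mul_mul 1
  rwa [Matrix.mul_one, hρ.trace_eq_one, one_smul] at this

lemma trace_commutator_mul_commutator (A B : Matrix n n ℂ) :
    Matrix.trace ((ρ * A - A * ρ) * (ρ * B - B * ρ)) =
      2 * (Matrix.trace (ρ * A) * Matrix.trace (ρ * B)) -
        (Matrix.trace (ρ * (A * B)) + Matrix.trace (ρ * (B * A))) := by
  have e : (ρ * A - A * ρ) * (ρ * B - B * ρ) =
      (ρ * A * ρ) * B - (ρ * (A * B)) * ρ - (A * (ρ * ρ)) * B + A * (ρ * B * ρ) := by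
    noncomm_ring
  rw [e, hρ.mul_mul, hρ.mul_mul, hρ.mul_mul, hρ.mul_self, Matrix.trace_add,
    Matrix.trace_sub, Matrix.trace_sub,
    Matrix.trace_mul_comm (A * ρ) B,
    ← Matrix.mul_assoc B, Matrix.trace_mul_comm (B * A) ρ, Matrix.smul_mul, Matrix.mul_smul,
    Matrix.trace_smul, Matrix.trace_smul, Matrix.trace_smul, Matrix.trace_mul_comm A ρ,
    hρ.trace_eq_one]
  simp only [smul_eq_mul]
  ring

lemma norm_trace_commutator_mul_commutator_le (A B : Matrix n n ℂ) :
    ‖Matrix.trace ((ρ * A - A * ρ) * (ρ * B - B * ρ))‖ ≤ 4 * (‖A‖ * ‖B‖) := by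
  rw [hρ.trace_commutator_mul_commutator]
  have h1 : ‖Matrix.trace (ρ * A) * Matrix.trace (ρ * B)‖ ≤ ‖A‖ * ‖B‖ := by
    rw [norm_mul]
    exact mul_le_mul (hρ.norm_trace_mul_le A) (hρ.norm_trace_mul_le B) (norm_nonneg _)
      (norm_nonneg _)
  have h2 := (hρ.norm_trace_mul_le (A * B)).trans (norm_mul_le A B)
  have h3 := (hρ.norm_trace_mul_le (B * A)).trans (norm_mul_le B A)
  have h4 := norm_sub_le (2 * (Matrix.trace (ρ * A) * Matrix.trace (ρ * B)))
    (Matrix.trace (ρ * (A * B)) + Matrix.trace (ρ * (B * A)))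
  have h5 := norm_add_le (Matrix.trace (ρ * (A * B))) (Matrix.trace (ρ * (B * A)))
  rw [norm_mul, RCLike.norm_ofNat] at h4
  linarith

lemma trace_mul_im_eq_zero {X : Matrix n n ℂ} (hX : X.IsHermitian) :
    (Matrix.trace (ρ * X)).im = 0 := by
  rw [← Complex.conj_eq_iff_im, ← Complex.star_def, ← Matrix.trace_conjTranspose,
    Matrix.conjTranspose_mul, hρ.isHermitian, hX, Matrix.trace_mul_comm]

/-- The divergence of `poissonField H` weighted by the exponential of `s` times the variance. -/
lemma sum_fderiv_poissonField_mul_exp {H : Matrix n n ℂ} (hH : Matrix.trace H = 0) (s : ℂ) :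
    ∑ i, ∑ j, fderiv ℂ
      (fun M => entryCLM i j (poissonField H M) * Complex.exp (s * variancePoly H M)) ρ
      (Matrix.single i j 1 * ρ - ρ * Matrix.single i j 1) =
      ((2 * Fintype.card n + 2) * variancePoly H ρ - 2 * Matrix.trace (H * H) + s *
        Matrix.trace ((ρ * (H * H - (2 * Matrix.trace (ρ * H)) • H) -
          (H * H - (2 * Matrix.trace (ρ * H)) • H) * ρ) *
          (ρ * (H * H - Matrix.trace (ρ * H) • H) -
          (H * H - Matrix.trace (ρ * H) • H) * ρ))) * Complex.exp (s * variancePoly H ρ) := by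
  simp only [fderiv_poissonField_mul_exp]
  simp only [← Finset.sum_mul]
  congr 1
  simp only [trace_single_commutator_mul, Finset.sum_add_distrib, Finset.sum_sub_distrib,
    sum_double_commutator_apply, sum_apply_mul_apply_swap, ← Finset.mul_sum]
  simp only [mul_comm (poissonField H ρ _ _), sum_apply_mul_apply_swap]
  have h1 := hρ.trace_commutator_mul_commutator H H
  rw [h1, hρ.trace_eq_one]
  simp only [poissonField, variancePoly, traceMulCLM_apply, Matrix.mul_sub, Matrix.trace_sub,
    Matrix.mul_smul, Matrix.trace_smul, hH, smul_eq_mul]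
  ring

end IsPureState

lemma isPureState_rotatedState {ψ : n → ℂ} (hψ : star ψ ⬝ᵥ ψ = 1)
    (U : Matrix.specialUnitaryGroup n ℂ) : IsPureState (rotatedState ψ U) := by
  rw [rotatedState_eq_vecMulVec]
  exact isPureState_vecMulVec
    (star_dotProduct_mulVec_unitary (star_mul_self_of_specialUnitary U) hψ)

lemma IsPureState.variancePoly_eq_ofReal {ρ H : Matrix n n ℂ} (hρ : IsPureState ρ)
    (hH : H.IsHermitian) : variancePoly H ρ = ((variancePoly H ρ).re : ℂ) := by
  have h1 : (Matrix.trace (ρ * H)).im = 0 := hρ.trace_mul_im_eq_zero hH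
  have h2 : (Matrix.trace (ρ * (H * H))).im = 0 :=
    hρ.trace_mul_im_eq_zero (by rw [Matrix.IsHermitian, Matrix.conjTranspose_mul, hH])
  apply Complex.ext
  · simp
  · simp [variancePoly, traceMulCLM_apply, h1, h2, pow_two]

/-- The right-hand side of the Stein identity for the variance. -/
def steinTerm (H M : Matrix n n ℂ) : ℂ :=
  Matrix.trace ((M * (H * H - (2 * traceMulCLM H M) • H) -
    (H * H - (2 * traceMulCLM H M) • H) * M) *
    (M * (H * H - traceMulCLM H M • H) - (H * H - traceMulCLM H M • H) * M))

lemma continuous_steinTerm (H : Matrix n n ℂ) : Continuous (steinTerm H) := by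
  unfold steinTerm
  fun_prop

lemma IsPureState.norm_steinTerm_le {ρ : Matrix n n ℂ} (hρ : IsPureState ρ) (H : Matrix n n ℂ) :
    ‖steinTerm H ρ‖ ≤ 24 * ‖H‖ ^ 4 := by
  refine (hρ.norm_trace_commutator_mul_commutator_le _ _).trans ?_
  have hq : ‖traceMulCLM H ρ‖ ≤ ‖H‖ := hρ.norm_trace_mul_le H
  have h0 := norm_mul_le H H
  have h1 : ‖H * H - (2 * traceMulCLM H ρ) • H‖ ≤ 3 * ‖H‖ ^ 2 := by
    refine (norm_sub_le _ _).trans ?_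
    rw [norm_smul, norm_mul (2 : ℂ), RCLike.norm_ofNat]
    nlinarith [norm_nonneg H]
  have h2 : ‖H * H - traceMulCLM H ρ • H‖ ≤ 2 * ‖H‖ ^ 2 := by
    refine (norm_sub_le _ _).trans ?_
    rw [norm_smul]
    nlinarith [norm_nonneg H]
  calc 4 * (‖H * H - (2 * traceMulCLM H ρ) • H‖ * ‖H * H - traceMulCLM H ρ • H‖)
      ≤ 4 * ((3 * ‖H‖ ^ 2) * (2 * ‖H‖ ^ 2)) := by gcongr
    _ = 24 * ‖H‖ ^ 4 := by ring

/-- Stein identity for the exponentially tilted variance. -/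
lemma integral_stein_eq_zero [Nonempty n] {ψ : n → ℂ} (hψ : star ψ ⬝ᵥ ψ = 1) {H : Matrix n n ℂ}
    (hH : Matrix.trace H = 0) (s : ℂ) :
    ∫ U, ((2 * Fintype.card n + 2) * variancePoly H (rotatedState ψ U) -
      2 * Matrix.trace (H * H) + s * steinTerm H (rotatedState ψ U)) *
      Complex.exp (s * variancePoly H (rotatedState ψ U)) ∂μ = 0 := by
  have hΦ (i j : n) : ContDiff ℂ 1
      (fun M => entryCLM i j (poissonField H M) * Complex.exp (s * variancePoly H M)) := by
    have h1 := contDiff_poissonField H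
    have h2 := contDiff_variancePoly H
    fun_prop
  have hint (i j : n) : Integrable (fun U => fderiv ℂ
      (fun M => entryCLM i j (poissonField H M) * Complex.exp (s * variancePoly H M))
      (rotatedState ψ U)
      (Matrix.single i j 1 * rotatedState ψ U - rotatedState ψ U * Matrix.single i j 1)) μ :=
    integrable_comp_rotatedState (Φ := fun M => fderiv ℂ (fun M => entryCLM i j
      (poissonField H M) * Complex.exp (s * variancePoly H M)) M
      (Matrix.single i j 1 * M - M * Matrix.single i j 1)) μ hψ
      (((hΦ i j).continuous_fderiv one_ne_zero).clm_apply (by fun_prop))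
  calc _ = ∫ U, ∑ i, ∑ j, fderiv ℂ
        (fun M => entryCLM i j (poissonField H M) * Complex.exp (s * variancePoly H M))
        (rotatedState ψ U)
        (Matrix.single i j 1 * rotatedState ψ U - rotatedState ψ U * Matrix.single i j 1) ∂μ := by
        congr 1
        ext U
        exact ((isPureState_rotatedState hψ U).sum_fderiv_poissonField_mul_exp hH s).symm
    _ = 0 := by
        rw [integral_finsetSum _ fun i _ => integrable_finsetSum _ fun j _ => hint i j]
        refine Finset.sum_eq_zero fun i _ => ?_
        rw [integral_finsetSum _ fun j _ => hint i j]
        exact Finset.sum_eq_zero fun j _ => integral_fderiv_commutator μ hψ (hΦ i j) _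

lemma integral_mul_exp_le_of_stein [Nonempty n] {ψ : n → ℂ} (hψ : star ψ ⬝ᵥ ψ = 1)
    {H : Matrix n n ℂ} (hHerm : H.IsHermitian) (hH : Matrix.trace H = 0) {t : ℝ} (ht : 0 ≤ t) :
    ∫ U, ((Matrix.trace (H * H)).re / (Fintype.card n + 1) -
        (variancePoly H (rotatedState ψ U)).re) *
      Real.exp (t * ((Matrix.trace (H * H)).re / (Fintype.card n + 1) -
        (variancePoly H (rotatedState ψ U)).re)) ∂μ ≤
    12 * ‖H‖ ^ 4 / (Fintype.card n + 1) * t *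
      ∫ U, Real.exp (t * ((Matrix.trace (H * H)).re / (Fintype.card n + 1) -
        (variancePoly H (rotatedState ψ U)).re)) ∂μ := by
  set D : ℝ := (Fintype.card n : ℝ) with hD
  have hD0 : 0 < D + 1 := by positivity
  set m := (Matrix.trace (H * H)).re / (D + 1) with hm
  set v := fun U => (variancePoly H (rotatedState ψ U)).re with hv
  have hvM : Continuous fun M : Matrix n n ℂ => (variancePoly H M).re :=
    Complex.continuous_re.comp (contDiff_variancePoly H).continuous
  have htr : Matrix.trace (H * H) = ((Matrix.trace (H * H)).re : ℂ) := by
    refine (Complex.conj_eq_iff_re.1 ?_).symm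
    rw [← Complex.star_def, ← Matrix.trace_conjTranspose, Matrix.conjTranspose_mul, hHerm]
  have h0 := integral_stein_eq_zero μ hψ hH (-(t : ℂ))
  have h1 : ∫ U, ((2 * D + 2) * v U - 2 * (Matrix.trace (H * H)).re -
      t * (steinTerm H (rotatedState ψ U)).re) * Real.exp (-t * v U) ∂μ = 0 := by
    rw [← Complex.zero_re, ← h0, ← RCLike.re_eq_complex_re, ← integral_re]
    · congr 1
      ext U
      rw [(isPureState_rotatedState hψ U).variancePoly_eq_ofReal hHerm, htr,
        ← Complex.ofReal_neg, ← Complex.ofReal_mul, ← Complex.ofReal_exp,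
        RCLike.re_eq_complex_re, Complex.re_mul_ofReal]
      simp [hv, hD, sub_eq_add_neg]
    · apply integrable_comp_rotatedState μ hψ (Φ := fun M => ((2 * Fintype.card n + 2) *
        variancePoly H M - 2 * Matrix.trace (H * H) + -(t : ℂ) * steinTerm H M) *
        Complex.exp (-(t : ℂ) * variancePoly H M))
      have h2 := (contDiff_variancePoly H).continuous
      have h3 := continuous_steinTerm H
      fun_prop
  have hI1 : Integrable (fun U => (m - v U) * Real.exp (t * (m - v U))) μ :=
    integrable_comp_rotatedState μ hψ (Φ := fun M => (m - (variancePoly H M).re) *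
      Real.exp (t * (m - (variancePoly H M).re))) (by fun_prop)
  have hI2 : Integrable (fun U => Real.exp (t * (m - v U))) μ :=
    integrable_comp_rotatedState μ hψ (Φ := fun M =>
      Real.exp (t * (m - (variancePoly H M).re))) (by fun_prop)
  have hI3 : Integrable (fun U => ((2 * D + 2) * v U - 2 * (Matrix.trace (H * H)).re -
      t * (steinTerm H (rotatedState ψ U)).re) * Real.exp (-t * v U)) μ := by
    have h3 : Continuous fun M : Matrix n n ℂ => (steinTerm H M).re :=
      Complex.continuous_re.comp (continuous_steinTerm H)
    exact integrable_comp_rotatedState μ hψ (Φ := fun M => ((2 * D + 2) * (variancePoly H M).re -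
      2 * (Matrix.trace (H * H)).re - t * (steinTerm H M).re) *
      Real.exp (-t * (variancePoly H M).re)) (by fun_prop)
  rw [← integral_const_mul, ← sub_nonneg, ← integral_sub (hI2.const_mul _) hI1]
  have h4 : ∫ U, Real.exp (t * m) / (2 * (D + 1)) *
      (((2 * D + 2) * v U - 2 * (Matrix.trace (H * H)).re -
      t * (steinTerm H (rotatedState ψ U)).re) * Real.exp (-t * v U)) ∂μ = 0 := by
    rw [integral_const_mul, h1, mul_zero]
  rw [← h4]
  refine integral_mono (hI3.const_mul _) ((hI2.const_mul _).sub hI1) fun U => ?_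
  have h5 := (abs_le.1 ((Complex.abs_re_le_norm _).trans
    ((isPureState_rotatedState hψ U).norm_steinTerm_le H))).1
  have h6 : Real.exp (t * (m - v U)) = Real.exp (t * m) * Real.exp (-t * v U) := by
    rw [← Real.exp_add]
    ring_nf
  have h7 : (Matrix.trace (H * H)).re = m * (D + 1) := by
    rw [hm]
    field_simp
  simp only [h6, h7]
  have h8 : 0 ≤ t * (24 * ‖H‖ ^ 4 + (steinTerm H (rotatedState ψ U)).re) *
      (Real.exp (t * m) * Real.exp (-t * v U)) / (2 * (D + 1)) := by
    have : 0 ≤ 24 * ‖H‖ ^ 4 + (steinTerm H (rotatedState ψ U)).re := by linarith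
    positivity
  refine sub_nonneg.1 (h8.trans_eq ?_)
  field_simp
  ring

end Unitary

section Chernoff

open ProbabilityTheory

/-- Chernoff bound from a differential inequality for the moment generating function. -/
lemma measureReal_ge_le_exp_of_integral_mul_exp_le {Ω : Type*} [MeasurableSpace Ω]
    {μ : Measure Ω} [IsProbabilityMeasure μ] {X : Ω → ℝ} {C c : ℝ} (hX : AEMeasurable X μ)
    (hXC : ∀ ω, |X ω| ≤ C) (hc : 0 < c)
    (h : ∀ t, 0 ≤ t → ∫ ω, X ω * Real.exp (t * X ω) ∂μ ≤ c * t * ∫ ω, Real.exp (t * X ω) ∂μ)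
    {δ : ℝ} (hδ : 0 ≤ δ) :
    μ.real {ω | δ ≤ X ω} ≤ Real.exp (-(δ ^ 2 / (2 * c))) := by
  have hint (t : ℝ) : Integrable (fun ω => Real.exp (t * X ω)) μ :=
    integrable_exp_mul_of_mem_Icc (a := -C) (b := C) hX (.of_forall fun ω => abs_le.1 (hXC ω))
  have huniv : integrableExpSet X μ = Set.univ := Set.eq_univ_of_forall hint
  have hderiv (t : ℝ) : HasDerivAt (mgf X μ) (∫ ω, X ω * Real.exp (t * X ω) ∂μ) t :=
    hasDerivAt_mgf (by rw [huniv, interior_univ]; trivial)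
  have hderiv' (t : ℝ) : HasDerivAt (fun t => mgf X μ t * Real.exp (-(c * t ^ 2 / 2)))
      ((∫ ω, X ω * Real.exp (t * X ω) ∂μ - c * t * mgf X μ t) * Real.exp (-(c * t ^ 2 / 2))) t := by
    have h1 : HasDerivAt (fun t : ℝ => -(c * t ^ 2 / 2)) (-(c * t)) t := by
      refine ((((hasDerivAt_id t).pow 2).const_mul c).div_const 2).neg.congr_deriv ?_
      simp
      ring
    refine ((hderiv t).mul h1.exp).congr_deriv ?_
    ring
  have hanti : AntitoneOn (fun t => mgf X μ t * Real.exp (-(c * t ^ 2 / 2))) (Set.Ici 0) := by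
    refine antitoneOn_of_deriv_nonpos (convex_Ici 0)
      (fun t _ => (hderiv' t).continuousAt.continuousWithinAt)
      (fun t _ => (hderiv' t).differentiableAt.differentiableWithinAt) fun t ht => ?_
    rw [interior_Ici] at ht
    rw [(hderiv' t).deriv]
    exact mul_nonpos_of_nonpos_of_nonneg (sub_nonpos.2 (h t (le_of_lt ht))) (Real.exp_nonneg _)
  have ht0 : 0 ≤ δ / c := by positivity
  have h1 := hanti (Set.mem_Ici.2 le_rfl) (Set.mem_Ici.2 ht0) ht0
  simp only [mgf_zero, ne_eq, OfNat.ofNat_ne_zero, not_false_eq_true, zero_pow, mul_zero, zero_div,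
    neg_zero, Real.exp_zero, mul_one] at h1
  have h2 : mgf X μ (δ / c) ≤ Real.exp (c * (δ / c) ^ 2 / 2) := by
    rw [Real.exp_neg, ← div_eq_mul_inv, div_le_one (Real.exp_pos _)] at h1
    exact h1
  calc μ.real {ω | δ ≤ X ω} ≤ Real.exp (-(δ / c) * δ) * mgf X μ (δ / c) :=
        measure_ge_le_exp_mul_mgf δ ht0 (hint _)
    _ ≤ Real.exp (-(δ / c) * δ) * Real.exp (c * (δ / c) ^ 2 / 2) := by gcongr
    _ = Real.exp (-(δ ^ 2 / (2 * c))) := by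
        rw [← Real.exp_add]
        congr 1
        field_simp
        ring

end Chernoff

section Unitary

open scoped Matrix.Norms.L2Operator

/-- Lower-tail concentration of the variance of a traceless observable in a random pure state. -/
lemma variance_lower_tail {n : Type*} [Fintype n] [DecidableEq n] [Nonempty n]
    (μ : Measure (Matrix.specialUnitaryGroup n ℂ)) [IsProbabilityMeasure μ]
    [μ.IsMulLeftInvariant] {ψ : n → ℂ} (hψ : star ψ ⬝ᵥ ψ = 1)
    {H : Matrix n n ℂ} (hHerm : H.IsHermitian) (hH : Matrix.trace H = 0) {K : ℝ} (hK : ‖H‖ ≤ K)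
    (hK0 : 0 < K) {δ : ℝ} (hδ : 0 ≤ δ) :
    μ.real {U | (variancePoly H (rotatedState ψ U)).re ≤
      (Matrix.trace (H * H)).re / (Fintype.card n + 1) - δ} ≤
      Real.exp (-(δ ^ 2 * (Fintype.card n + 1) / (24 * K ^ 4))) := by
  have hvM : Continuous fun M : Matrix n n ℂ => (variancePoly H M).re :=
    Complex.continuous_re.comp (contDiff_variancePoly H).continuous
  have hXM : Continuous fun M : Matrix n n ℂ =>
    (Matrix.trace (H * H)).re / (Fintype.card n + 1) - (variancePoly H M).re := by fun_prop
  obtain ⟨C, hC⟩ := exists_bound_comp_rotatedState hψ hXM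
  have key := measureReal_ge_le_exp_of_integral_mul_exp_le (μ := μ)
    (X := fun U => (Matrix.trace (H * H)).re / (Fintype.card n + 1) -
      (variancePoly H (rotatedState ψ U)).re)
    (c := 12 * K ^ 4 / (Fintype.card n + 1))
    (hXM.comp (continuous_rotatedState ψ)).measurable.aemeasurable hC (by positivity)
    (fun t ht => (integral_mul_exp_le_of_stein μ hψ hHerm hH ht).trans (by
      have : 0 ≤ ∫ U, Real.exp (t * ((Matrix.trace (H * H)).re / (Fintype.card n + 1) -
        (variancePoly H (rotatedState ψ U)).re)) ∂μ := integral_nonneg fun _ => Real.exp_nonneg _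
      refine mul_le_mul_of_nonneg_right ?_ this
      gcongr)) hδ
  convert key using 2
  · ext U
    simp only [Set.mem_ofPred_eq]
    constructor <;> intro h <;> linarith
  · field_simp
    ring

end Unitary

section TensorProd

variable {d N : ℕ}

lemma tensorProd_mul (V W : Fin N → Matrix (Fin d) (Fin d) ℂ) :
    tensorProd V * tensorProd W = tensorProd fun j => V j * W j := by
  ext x y
  simp only [Matrix.mul_apply, tensorProd, Matrix.of_apply, ← Finset.prod_mul_distrib]
  rw [Finset.prod_univ_sum, Fintype.piFinset_univ]

lemma star_tensorProd (V : Fin N → Matrix (Fin d) (Fin d) ℂ) :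
    star (tensorProd V) = tensorProd fun j => star (V j) := by
  ext x y
  simp [tensorProd, Matrix.star_apply]

lemma tensorProd_one : tensorProd (1 : Fin N → Matrix (Fin d) (Fin d) ℂ) = 1 := by
  ext x y
  simp only [tensorProd, Matrix.of_apply, Pi.one_apply, Matrix.one_apply, Finset.prod_boole,
    Finset.mem_univ, true_implies, funext_iff]

lemma trace_tensorProd (V : Fin N → Matrix (Fin d) (Fin d) ℂ) :
    Matrix.trace (tensorProd V) = ∏ j, Matrix.trace (V j) := by
  simp only [Matrix.trace, Matrix.diag, tensorProd, Matrix.of_apply]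
  rw [Finset.prod_univ_sum, Fintype.piFinset_univ]

/-- The one-particle matrix `h` acting on the `j`-th tensor factor. -/
def siteOp (j : Fin N) (h : Matrix (Fin d) (Fin d) ℂ) :
    Matrix (Fin N → Fin d) (Fin N → Fin d) ℂ :=
  Matrix.of fun x y => if ∀ i, i ≠ j → x i = y i then h (x j) (y j) else 0

lemma siteOp_eq_tensorProd (j : Fin N) (h : Matrix (Fin d) (Fin d) ℂ) :
    siteOp j h = tensorProd (Function.update 1 j h) := by
  ext x y
  simp only [siteOp, tensorProd, Matrix.of_apply]
  rw [Fintype.prod_eq_mul_prod_compl j, Function.update_self]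
  have : ∏ i ∈ {j}ᶜ, Function.update (1 : Fin N → Matrix (Fin d) (Fin d) ℂ) j h i (x i) (y i) =
      if ∀ i, i ≠ j → x i = y i then 1 else 0 := by
    rw [Finset.prod_congr rfl (g := fun i => if x i = y i then (1 : ℂ) else 0)]
    · simp [Finset.prod_boole]
    · intro i hi
      rw [Function.update_of_ne (by simpa using hi), Pi.one_apply, Matrix.one_apply]
  rw [this, mul_ite, mul_one, mul_zero]

lemma siteOp_mul (j : Fin N) (g h : Matrix (Fin d) (Fin d) ℂ) :
    siteOp j (g * h) = siteOp j g * siteOp j h := by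
  simp only [siteOp_eq_tensorProd, tensorProd_mul]
  congr 1
  ext i : 1
  obtain rfl | hi := eq_or_ne i j <;> simp [*]

lemma siteOp_star (j : Fin N) (h : Matrix (Fin d) (Fin d) ℂ) :
    siteOp j (star h) = star (siteOp j h) := by
  simp only [siteOp_eq_tensorProd, star_tensorProd]
  congr 1
  ext i : 1
  obtain rfl | hi := eq_or_ne i j <;> simp [*]

lemma trace_siteOp (j : Fin N) (h : Matrix (Fin d) (Fin d) ℂ) :
    Matrix.trace (siteOp j h) = Matrix.trace h * d ^ (N - 1) := by
  rw [siteOp_eq_tensorProd, trace_tensorProd, Fintype.prod_eq_mul_prod_compl j,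
    Function.update_self, Finset.prod_congr rfl (g := fun _ => (d : ℂ))]
  · simp [Finset.card_compl]
  · intro i hi
    rw [Function.update_of_ne (by simpa using hi), Pi.one_apply, Matrix.trace_one,
      Fintype.card_fin]

lemma trace_siteOp_mul_siteOp_of_ne {j k : Fin N} (hjk : j ≠ k)
    {h : Matrix (Fin d) (Fin d) ℂ} (htr : Matrix.trace h = 0) (g : Matrix (Fin d) (Fin d) ℂ) :
    Matrix.trace (siteOp j h * siteOp k g) = 0 := by
  rw [siteOp_eq_tensorProd, siteOp_eq_tensorProd, tensorProd_mul, trace_tensorProd]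
  refine Finset.prod_eq_zero (Finset.mem_univ j) ?_
  rw [Function.update_self, Function.update_of_ne hjk, Pi.one_apply, mul_one, htr]

/-- `siteOp` as a star homomorphism. -/
def siteHom (j : Fin N) :
    Matrix (Fin d) (Fin d) ℂ →⋆ₙₐ[ℂ] Matrix (Fin N → Fin d) (Fin N → Fin d) ℂ where
  toFun := siteOp j
  map_smul' c h := by
    ext x y
    simp [siteOp]
  map_zero' := by
    ext x y
    simp [siteOp]
  map_add' g h := by
    ext x y
    simp only [siteOp, Matrix.of_apply, Matrix.add_apply]
    split_ifs <;> simp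
  map_mul' := siteOp_mul j
  map_star' := siteOp_star j

open scoped Matrix.Norms.L2Operator in
lemma norm_siteOp_le (j : Fin N) (h : Matrix (Fin d) (Fin d) ℂ) : ‖siteOp j h‖ ≤ opNorm h :=
  NonUnitalStarAlgHom.norm_apply_le (siteHom j) h

lemma localHam_eq_sum_siteOp (h : Matrix (Fin d) (Fin d) ℂ) :
    localHam d N h = ∑ j, siteOp j h := rfl

lemma isHermitian_localHam {h : Matrix (Fin d) (Fin d) ℂ} (hherm : h.IsHermitian) :
    (localHam d N h).IsHermitian := by
  have : star (localHam d N h) = localHam d N h := by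
    rw [localHam_eq_sum_siteOp, star_sum]
    refine Finset.sum_congr rfl fun j _ => ?_
    rw [← siteOp_star, Matrix.star_eq_conjTranspose, hherm]
  exact this

lemma trace_localHam {h : Matrix (Fin d) (Fin d) ℂ} (htr : Matrix.trace h = 0) :
    Matrix.trace (localHam d N h) = 0 := by
  simp [localHam_eq_sum_siteOp, Matrix.trace_sum, trace_siteOp, htr]

lemma trace_localHam_mul_self {h : Matrix (Fin d) (Fin d) ℂ} (htr : Matrix.trace h = 0) :
    Matrix.trace (localHam d N h * localHam d N h) =
      N * (Matrix.trace (h * h) * d ^ (N - 1)) := by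
  have h1 (j : Fin N) : ∑ k, Matrix.trace (siteOp j h * siteOp k h) =
      Matrix.trace (h * h) * d ^ (N - 1) := by
    rw [Finset.sum_eq_single j, ← siteOp_mul, trace_siteOp]
    · exact fun k _ hk => trace_siteOp_mul_siteOp_of_ne hk.symm htr h
    · simp
  simp only [localHam_eq_sum_siteOp, Finset.sum_mul_sum, Matrix.trace_sum, h1]
  simp

open scoped Matrix.Norms.L2Operator in
lemma norm_localHam_le (h : Matrix (Fin d) (Fin d) ℂ) : ‖localHam d N h‖ ≤ N * opNorm h := by
  rw [localHam_eq_sum_siteOp]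
  simpa using norm_sum_le_of_le Finset.univ fun j _ => norm_siteOp_le j h

lemma star_tensorProd_mul_self (V : Fin N → Matrix.unitaryGroup (Fin d) ℂ) :
    star (tensorProd fun j => (V j : Matrix (Fin d) (Fin d) ℂ)) *
      (tensorProd fun j => (V j : Matrix (Fin d) (Fin d) ℂ)) = 1 := by
  rw [star_tensorProd, tensorProd_mul, ← tensorProd_one]
  congr 1
  ext j : 1
  exact Matrix.mem_unitaryGroup_iff'.1 (V j).2

open scoped Matrix.Norms.L2Operator in
/-- The value at the identity is a lower bound for the supremum defining `FLU`. -/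
lemma four_mul_variancePoly_le_FLU {h : Matrix (Fin d) (Fin d) ℂ} (hherm : h.IsHermitian)
    {ψ : (Fin N → Fin d) → ℂ} (hψ : star ψ ⬝ᵥ ψ = 1)
    (U : Matrix.specialUnitaryGroup (Fin N → Fin d) ℂ) :
    4 * (variancePoly (localHam d N h) (rotatedState ψ U)).re ≤ FLU d N h ψ U := by
  have hbdd := le_ciSup (f := fun V : Fin N → Matrix.unitaryGroup (Fin d) ℂ =>
    4 * ((Matrix.trace ((tensorProd fun j => (V j : Matrix (Fin d) (Fin d) ℂ)) *
      rotatedState ψ U * star (tensorProd fun j => (V j : Matrix (Fin d) (Fin d) ℂ)) *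
      (localHam d N h * localHam d N h))).re -
    ((Matrix.trace ((tensorProd fun j => (V j : Matrix (Fin d) (Fin d) ℂ)) *
      rotatedState ψ U * star (tensorProd fun j => (V j : Matrix (Fin d) (Fin d) ℂ)) *
      localHam d N h)).re) ^ 2)) ⟨4 * ‖localHam d N h * localHam d N h‖, ?_⟩ 1
  · refine le_trans (le_of_eq ?_) hbdd
    have h1 : (tensorProd fun j => (((1 : Fin N → Matrix.unitaryGroup (Fin d) ℂ) j :
        Matrix.unitaryGroup (Fin d) ℂ) : Matrix (Fin d) (Fin d) ℂ)) = 1 := tensorProd_one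
    have h2 := (isPureState_rotatedState hψ U).trace_mul_im_eq_zero
      (isHermitian_localHam (N := N) hherm)
    simp only [h1, star_one, one_mul, mul_one]
    simp [variancePoly, traceMulCLM_apply, pow_two, h2]
  · rintro _ ⟨V, rfl⟩
    have h1 : (tensorProd fun j => (V j : Matrix (Fin d) (Fin d) ℂ)) * rotatedState ψ U *
        star (tensorProd fun j => (V j : Matrix (Fin d) (Fin d) ℂ)) =
        Matrix.vecMulVec (tensorProd (fun j => (V j : Matrix (Fin d) (Fin d) ℂ)) *ᵥ (U.1 *ᵥ ψ))
          (star (tensorProd (fun j => (V j : Matrix (Fin d) (Fin d) ℂ)) *ᵥ (U.1 *ᵥ ψ))) := by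
      rw [rotatedState_eq_vecMulVec, Matrix.mul_vecMulVec, Matrix.vecMulVec_mul,
        Matrix.star_mulVec _ (U.1 *ᵥ ψ)]
      rfl
    have h2 := (isPureState_vecMulVec (star_dotProduct_mulVec_unitary
      (star_tensorProd_mul_self V) (star_dotProduct_mulVec_unitary
      (star_mul_self_of_specialUnitary U) hψ))).norm_trace_mul_le
      (localHam d N h * localHam d N h)
    rw [← h1] at h2
    have h3 := (Complex.re_le_norm _).trans h2
    dsimp only
    linarith [sq_nonneg (Matrix.trace ((tensorProd fun j => (V j : Matrix (Fin d) (Fin d) ℂ)) *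
      rotatedState ψ U * star (tensorProd fun j => (V j : Matrix (Fin d) (Fin d) ℂ)) *
      localHam d N h)).re]

end TensorProd

/-- lower-tail concentration bound for the LU-optimized QFI of Haar-random
pure states of `N` distinguishable particles. -/
theorem flu_lower_tail (d N : ℕ) (hd : 2 ≤ d) (hN : 1 ≤ N)
    (h : Matrix (Fin d) (Fin d) ℂ) (hherm : h.IsHermitian) (htr : Matrix.trace h = 0)
    (ψ : (Fin N → Fin d) → ℂ) (hψ : ∑ x, ‖ψ x‖ ^ 2 = 1)
    (μ : Measure (Matrix.specialUnitaryGroup (Fin N → Fin d) ℂ))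
    [IsProbabilityMeasure μ] [μ.IsMulLeftInvariant]
    (ε : ℝ) (hε : 0 ≤ ε) :
    μ {U | FLU d N h ψ U ≤
            4 * N * (Matrix.trace (h * h)).re * d ^ N / (d * (d ^ N + 1)) - ε}
      ≤ ENNReal.ofReal
          (Real.exp (-(ε ^ 2 * d ^ N / (4096 * opNorm h ^ 4 * N ^ 4)))) := by
  have hψ' := star_dotProduct_self_of_unit hψ
  obtain h0 | h0 := (norm_nonneg (Matrix.toEuclideanCLM (𝕜 := ℂ) h)).eq_or_lt
  · have : opNorm h = 0 := h0.symm
    simpa [this] using prob_le_one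
  have hK : 0 < opNorm h := h0
  have hN' : 0 < (N : ℝ) := by exact_mod_cast hN
  have hd' : 0 < (d : ℝ) := by
    have : 0 < d := by lia
    exact_mod_cast this
  have : Nonempty (Fin d) := ⟨⟨0, by lia⟩⟩
  have key := variance_lower_tail μ hψ' (isHermitian_localHam hherm) (trace_localHam htr)
    (norm_localHam_le h) (by positivity) (δ := ε / 4) (by positivity)
  have hcard : (Fintype.card (Fin N → Fin d) : ℝ) = (d : ℝ) ^ N := by simp
  have htr2 : (Matrix.trace (localHam d N h * localHam d N h)).re =
      N * ((Matrix.trace (h * h)).re * (d : ℝ) ^ (N - 1)) := by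
    rw [trace_localHam_mul_self htr, ← Complex.ofReal_natCast, ← Complex.ofReal_natCast,
      ← Complex.ofReal_pow, Complex.re_ofReal_mul, Complex.re_mul_ofReal]
  have hpow : (d : ℝ) ^ N = d ^ (N - 1) * d := by rw [← pow_succ, Nat.sub_add_cancel hN]
  rw [hcard, htr2] at key
  calc _ ≤ μ {U | (variancePoly (localHam d N h) (rotatedState ψ U)).re ≤
        N * ((Matrix.trace (h * h)).re * (d : ℝ) ^ (N - 1)) / (d ^ N + 1) - ε / 4} := by
        refine measure_mono fun U hU => ?_
        have h1 : 4 * N * (Matrix.trace (h * h)).re * (d : ℝ) ^ N / (d * (d ^ N + 1)) =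
            4 * (N * ((Matrix.trace (h * h)).re * (d : ℝ) ^ (N - 1)) / (d ^ N + 1)) := by
          have h2 : (d : ℝ) ^ N + 1 ≠ 0 := by positivity
          generalize (d : ℝ) ^ N + 1 = D at h2
          rw [hpow]
          field_simp
        have h2 := (four_mul_variancePoly_le_FLU hherm hψ' U).trans hU
        rw [h1] at h2
        rw [Set.mem_ofPred_eq]
        linarith
    _ = ENNReal.ofReal (μ.real _) := (ofReal_measureReal).symm
    _ ≤ _ := by
        refine ENNReal.ofReal_le_ofReal (key.trans (Real.exp_le_exp.2 (neg_le_neg ?_)))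
        rw [mul_pow, div_le_div_iff₀ (by positivity) (by positivity)]
        have h3 : 0 ≤ ε ^ 2 * (opNorm h ^ 4 * N ^ 4) := by positivity
        have h4 : 0 < (d : ℝ) ^ N := by positivity
        nlinarith [mul_nonneg h3 h4.le]

end Paper
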